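/- arXiv:1501.04752 — 3 statements merged into one kernel-verified Lean document; each statement's English description precedes it below -/
import Mathlib

section
/- Let β : ℝ → ℝ and m > 0 be such that (β(s²)s − β(t²)t)(s − t) ≥ m(s − t)² for all real s, t ≥ 0. Then for all vectors p, q ∈ ℝ² one has (β(|p|²)p − β(|q|²)q) · (p − q) ≥ m|p − q|². -/
open scoped RealInnerProductSpace

/-- A radial field `x ↦ β(‖x‖²) x` on a real inner product space is strongly monotone as soon as
its profile `s ↦ β(s²) s` is strongly monotone on `[0, ∞)`. -/
theorem mul_norm_sub_sq_le_inner_radial {E : Type*} [NormedAddCommGroup E]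
    [InnerProductSpace ℝ E] {β : ℝ → ℝ} {m : ℝ}
    (hmono : ∀ s t : ℝ, 0 ≤ s → 0 ≤ t →
      m * (s - t) ^ 2 ≤ (β (s ^ 2) * s - β (t ^ 2) * t) * (s - t)) (p q : E) :
    m * ‖p - q‖ ^ 2 ≤ ⟪β (‖p‖ ^ 2) • p - β (‖q‖ ^ 2) • q, p - q⟫ := by
  have hβ (s : ℝ) (hs : 0 < s) : m ≤ β (s ^ 2) := by
    have h := hmono s 0 hs.le le_rfl
    have : 0 < s ^ 2 := by positivity
    nlinarith
  have hcross : 0 ≤ (β (‖p‖ ^ 2) + β (‖q‖ ^ 2) - 2 * m) * (‖p‖ * ‖q‖ - ⟪p, q⟫) := by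
    rcases eq_or_ne p 0 with rfl | hp
    · simp
    rcases eq_or_ne q 0 with rfl | hq
    · simp
    have hp' := hβ ‖p‖ (norm_pos_iff.mpr hp)
    have hq' := hβ ‖q‖ (norm_pos_iff.mpr hq)
    exact mul_nonneg (by linarith) (sub_nonneg.mpr (real_inner_le_norm p q))
  have h := hmono ‖p‖ ‖q‖ (norm_nonneg p) (norm_nonneg q)
  rw [norm_sub_sq_real]
  simp only [inner_sub_left, inner_sub_right, real_inner_smul_left, real_inner_self_eq_norm_sq,
    real_inner_comm p q]
  linarith

/-- Lemma 1 of the paper: pointwise strong monotonicity of the nonlinear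
magnetostatic operator `p ↦ β(|p|²) p` on `ℝ²`. -/
theorem strong_monotonicity_vector
    (β : ℝ → ℝ) (m : ℝ) (hm : 0 < m)
    (hmono : ∀ s t : ℝ, 0 ≤ s → 0 ≤ t →
      (β (s ^ 2) * s - β (t ^ 2) * t) * (s - t) ≥ m * (s - t) ^ 2) :
    ∀ p q : EuclideanSpace ℝ (Fin 2),
      ⟪β (‖p‖ ^ 2) • p - β (‖q‖ ^ 2) • q, p - q⟫ ≥ m * ‖p - q‖ ^ 2 :=
  mul_norm_sub_sq_le_inner_radial hmono
end

section
/- Let ν̂ : ℝ → ℝ be differentiable and m > 0 such that ν̂(s) ≥ m for all s ≥ 0 and ν̂(s) + ν̂'(s)s ≥ m for all s ≥ 0. Then for every ρ ∈ ℝ² with ρ ≠ 0 and every η ∈ ℝ², ν̂(|ρ|)|η|² + (ν̂'(|ρ|)/|ρ|)(ρ · η)² ≥ m|η|². -/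
open scoped RealInnerProductSpace

/-- Uniform positive definiteness of the matrix `ν̂(|ρ|) I₂ + (ν̂'(|ρ|)/|ρ|) ρ ⊗ ρ`
deduced from the physical properties (ii) and (iv) of the magnetic reluctivity
`ν̂` in Section 6 of the paper. -/
theorem quadratic_form_uniformly_positive
    (ν : ℝ → ℝ) (hν : Differentiable ℝ ν) (m : ℝ) (hm : 0 < m)
    (hlow : ∀ s : ℝ, 0 ≤ s → ν s ≥ m)
    (hderiv : ∀ s : ℝ, 0 ≤ s → ν s + deriv ν s * s ≥ m) :
    ∀ ρ : EuclideanSpace ℝ (Fin 2), ρ ≠ 0 →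
      ∀ η : EuclideanSpace ℝ (Fin 2),
        ν ‖ρ‖ * ‖η‖ ^ 2 + (deriv ν ‖ρ‖ / ‖ρ‖) * ⟪ρ, η⟫ ^ 2 ≥ m * ‖η‖ ^ 2 := by
  intro ρ hρ η
  have hr : 0 < ‖ρ‖ := norm_pos_iff.mpr hρ
  have hcs : ⟪ρ, η⟫ ^ 2 / ‖ρ‖ ^ 2 ≤ ‖η‖ ^ 2 := by
    rw [div_le_iff₀ (by positivity), ← mul_pow, mul_comm ‖η‖]
    exact sq_le_sq' (neg_le_of_abs_le (abs_real_inner_le_norm ρ η)) (real_inner_le_norm ρ η)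
  have heq : deriv ν ‖ρ‖ / ‖ρ‖ * ⟪ρ, η⟫ ^ 2 =
      deriv ν ‖ρ‖ * ‖ρ‖ * (⟪ρ, η⟫ ^ 2 / ‖ρ‖ ^ 2) := by
    field_simp
  have hnonneg : 0 ≤ ⟪ρ, η⟫ ^ 2 / ‖ρ‖ ^ 2 := by positivity
  rw [heq]
  have hperp := mul_nonneg (sub_nonneg.mpr (hlow ‖ρ‖ hr.le)) (sub_nonneg.mpr hcs)
  have hpar := mul_nonneg (sub_nonneg.mpr (hderiv ‖ρ‖ hr.le)) hnonneg
  linarith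
end

section
/- Let A : ℝ → M₂(ℝ) be a matrix-valued function that is differentiable at 0 with A(0) = I₂ and derivative A'(0) = B, and let n ∈ ℝ² be a unit vector. Then the real-valued map t ↦ det(A(t)) · |((A(t))⁻¹)ᵀ n| is differentiable at t = 0 with derivative tr B − (B n) · n. -/
attribute [local instance] Matrix.normedAddCommGroup Matrix.normedSpace

open Matrix
open scoped RealInnerProductSpace

/-- For a `2 × 2` matrix with positive determinant, `det M · |M⁻ᵀ n|` is the norm of the
cofactor matrix applied to `n`. -/
theorem det_mul_norm_inv_transpose (M : Matrix (Fin 2) (Fin 2) ℝ) (hM : 0 < M.det)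
    (n : EuclideanSpace ℝ (Fin 2)) :
    M.det * ‖Matrix.toEuclideanLin ((M⁻¹)ᵀ) n‖ =
      √((M 1 1 * n 0 - M 1 0 * n 1) ^ 2 + (M 0 0 * n 1 - M 0 1 * n 0) ^ 2) := by
  have hsmul : M.det • Matrix.toEuclideanLin ((M⁻¹)ᵀ) n =
      Matrix.toEuclideanLin M.adjugateᵀ n := by
    rw [← LinearMap.smul_apply, ← map_smul, ← Matrix.transpose_smul, Matrix.inv_def,
      Ring.inverse_eq_inv', smul_smul, mul_inv_cancel₀ hM.ne', one_smul]
  rw [← abs_of_pos hM, ← Real.norm_eq_abs, ← norm_smul, hsmul, EuclideanSpace.norm_eq]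
  congr 1
  simp [Fin.sum_univ_two, Matrix.adjugate_fin_two, Matrix.toLpLin_apply]
  ring

/-- The formula `ξ_τ'(0) = div V − (DV n)·n` for the derivative of the tangential
Jacobian `ξ_τ(t) = det(DT_t) |DT_t^{−T} n|` from the preliminary Lemma of
Section 4 of the paper. -/
theorem deriv_tangential_jacobian_at_zero
    (A : ℝ → Matrix (Fin 2) (Fin 2) ℝ) (B : Matrix (Fin 2) (Fin 2) ℝ)
    (hA : HasDerivAt A B 0) (hA0 : A 0 = 1)
    (n : EuclideanSpace ℝ (Fin 2)) (hn : ‖n‖ = 1) :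
    HasDerivAt (fun t : ℝ => (A t).det * ‖Matrix.toEuclideanLin (((A t)⁻¹)ᵀ) n‖)
      (B.trace - ⟪Matrix.toEuclideanLin B n, n⟫) 0 := by
  have hentry (i j : Fin 2) : HasDerivAt (fun t => A t i j) (B i j) 0 :=
    hasDerivAt_pi.1 (hasDerivAt_pi.1 hA i) j
  have hdet : ContinuousAt (fun t => (A t).det) 0 := by
    simp only [Matrix.det_fin_two]
    exact (((hentry 0 0).mul (hentry 1 1)).sub ((hentry 0 1).mul (hentry 1 0))).continuousAt
  have hpos : ∀ᶠ t in nhds 0, 0 < (A t).det :=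
    hdet.eventually (lt_mem_nhds (by simp [hA0]))
  have hn' : n 0 ^ 2 + n 1 ^ 2 = 1 := by
    simpa [hn, Fin.sum_univ_two] using (EuclideanSpace.norm_sq_eq n).symm
  have hsq := ((((hentry 1 1).mul_const (n 0)).sub ((hentry 1 0).mul_const (n 1))).pow 2).add
    ((((hentry 0 0).mul_const (n 1)).sub ((hentry 0 1).mul_const (n 0))).pow 2)
  have hsqrt := hsq.sqrt (by simp [hA0, hn'])
  refine (hsqrt.congr_of_eventuallyEq
    (hpos.mono fun t ht => det_mul_norm_inv_transpose (A t) ht n)).congr_deriv ?_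
  simp [hA0, hn', Fin.sum_univ_two, Matrix.trace_fin_two, Matrix.toLpLin_apply,
    PiLp.inner_apply]
  linear_combination (B 0 0 + B 1 1) * hn'
end
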